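/- arXiv:1612.01765 — 2 statements merged into one kernel-verified Lean document; each statement's English description precedes it below -/
import Mathlib

section
/- Let k, m, n be positive integers, let A_{ij} (for i = 1,...,k and j = 1,...,m) be n×n matrices with nonnegative real entries, and let α₁,...,αₘ be positive real numbers with α₁ + ⋯ + αₘ = 1. Then ‖(A₁₁^(α₁) ∘ ⋯ ∘ A₁ₘ^(αₘ)) ⋯ (A_{k1}^(α₁) ∘ ⋯ ∘ A_{km}^(αₘ))‖ ≤ ‖A₁₁A₂₁⋯A_{k1}‖^{α₁} ⋯ ‖A₁ₘA₂ₘ⋯A_{km}‖^{αₘ}. -/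
open scoped ENNReal NNReal BigOperators

/-- Spectral radius of a real matrix: the spectral radius of the corresponding
complex matrix (equivalently, the maximum modulus of its complex eigenvalues). -/
noncomputable def specRad {n : ℕ} (A : Matrix (Fin n) (Fin n) ℝ) : ℝ≥0∞ :=
  spectralRadius ℂ (A.map (fun x => (x : ℂ)))

/-- Operator norm of a real `n × n` matrix induced by the Euclidean norm on `ℝⁿ`. -/
noncomputable def opNorm {n : ℕ} (A : Matrix (Fin n) (Fin n) ℝ) : ℝ :=
  ‖LinearMap.toContinuousLinearMap (Matrix.toEuclideanLin A)‖

/-- The weighted Hadamard (Schur) geometric mean `A₁^(α₁) ∘ ⋯ ∘ Aₘ^(αₘ)`. -/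
noncomputable def hadWMean {n m : ℕ} (α : Fin m → ℝ)
    (A : Fin m → Matrix (Fin n) (Fin n) ℝ) : Matrix (Fin n) (Fin n) ℝ :=
  Matrix.of fun x y => ∏ j, (A j x y) ^ (α j)

/-- The ordered product `A 0 * A 1 * ⋯ * A (k-1)`. -/
def matListProd {n k : ℕ} (A : Fin k → Matrix (Fin n) (Fin n) ℝ) :
    Matrix (Fin n) (Fin n) ℝ :=
  (List.ofFn A).prod

/-- The set `Σ^k` of all products of `k` elements of `S`. -/
def setPow {n : ℕ} (S : Set (Matrix (Fin n) (Fin n) ℝ)) (k : ℕ) :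
    Set (Matrix (Fin n) (Fin n) ℝ) :=
  {B | ∃ A : Fin k → Matrix (Fin n) (Fin n) ℝ, (∀ i, A i ∈ S) ∧ B = matListProd A}

/-- The set `Ψ₁ Ψ₂ ⋯ Ψₘ` of products with the `j`-th factor from `Ψ j`. -/
def setProd {n m : ℕ} (Ψ : Fin m → Set (Matrix (Fin n) (Fin n) ℝ)) :
    Set (Matrix (Fin n) (Fin n) ℝ) :=
  {B | ∃ A : Fin m → Matrix (Fin n) (Fin n) ℝ, (∀ j, A j ∈ Ψ j) ∧ B = matListProd A}

/-- The weighted Hadamard geometric mean `Ψ₁^(α₁) ∘ ⋯ ∘ Ψₘ^(αₘ)` of sets. -/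
noncomputable def setHadWMean {n m : ℕ} (α : Fin m → ℝ)
    (Ψ : Fin m → Set (Matrix (Fin n) (Fin n) ℝ)) :
    Set (Matrix (Fin n) (Fin n) ℝ) :=
  {B | ∃ A : Fin m → Matrix (Fin n) (Fin n) ℝ, (∀ j, A j ∈ Ψ j) ∧ B = hadWMean α A}

/-- The generalized spectral radius `ρ(Σ) = limsup_{k→∞} (sup_{A ∈ Σ^k} ρ(A))^{1/k}`. -/
noncomputable def genSpecRad {n : ℕ} (S : Set (Matrix (Fin n) (Fin n) ℝ)) : ℝ≥0∞ :=
  Filter.atTop.limsup fun k : ℕ => (⨆ B ∈ setPow S k, specRad B) ^ (1 / (k : ℝ))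

/-- The joint spectral radius `ρ̂(Σ) = limsup_{k→∞} (sup_{A ∈ Σ^k} ‖A‖)^{1/k}`. -/
noncomputable def jointSpecRad {n : ℕ} (S : Set (Matrix (Fin n) (Fin n) ℝ)) : ℝ≥0∞ :=
  Filter.atTop.limsup fun k : ℕ =>
    (⨆ B ∈ setPow S k, ENNReal.ofReal (opNorm B)) ^ (1 / (k : ℝ))

open Finset in
/-- Hölder's inequality for a finite family of nonnegative functions on a finite set. -/
theorem sum_prod_rpow_le_prod_sum_rpow {ι κ : Type*} (s : Finset ι) (t : Finset κ)
    (f : κ → ι → ℝ) (hf : ∀ j ∈ t, ∀ i ∈ s, 0 ≤ f j i) (α : κ → ℝ) (hα : ∀ j ∈ t, 0 < α j)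
    (hαsum : ∑ j ∈ t, α j = 1) :
    ∑ i ∈ s, ∏ j ∈ t, f j i ^ α j ≤ ∏ j ∈ t, (∑ i ∈ s, f j i) ^ α j := by
  have hS : ∀ j ∈ t, 0 ≤ ∑ i ∈ s, f j i := fun j hj => sum_nonneg (hf j hj)
  by_cases h : ∃ j ∈ t, ∑ i ∈ s, f j i = 0
  · obtain ⟨j, hj, h0⟩ := h
    have hz := (sum_eq_zero_iff_of_nonneg (hf j hj)).1 h0
    rw [sum_eq_zero]
    · exact prod_nonneg fun j hj => Real.rpow_nonneg (hS j hj) _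
    · intro i hi
      exact prod_eq_zero hj (by rw [hz i hi, Real.zero_rpow (hα j hj).ne'])
  · push Not at h
    have hP : 0 ≤ ∏ j ∈ t, (∑ i ∈ s, f j i) ^ α j :=
      prod_nonneg fun j hj => Real.rpow_nonneg (hS j hj) _
    have key : ∀ i ∈ s, ∏ j ∈ t, f j i ^ α j ≤
        (∏ j ∈ t, (∑ i ∈ s, f j i) ^ α j) * ∑ j ∈ t, α j * (f j i / ∑ i ∈ s, f j i) := by
      intro i hi
      calc ∏ j ∈ t, f j i ^ α j
          = (∏ j ∈ t, (∑ i ∈ s, f j i) ^ α j) * ∏ j ∈ t, (f j i / ∑ i ∈ s, f j i) ^ α j := by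
            rw [← prod_mul_distrib]
            refine prod_congr rfl fun j hj => ?_
            rw [← Real.mul_rpow (hS j hj) (div_nonneg (hf j hj i hi) (hS j hj)),
              mul_div_cancel₀ _ (h j hj)]
        _ ≤ _ := mul_le_mul_of_nonneg_left
            (Real.geom_mean_le_arith_mean_weighted _ _ _ (fun j hj => (hα j hj).le) hαsum
              fun j hj => div_nonneg (hf j hj i hi) (hS j hj)) hP
    refine (sum_le_sum key).trans_eq ?_
    rw [← mul_sum, sum_comm]
    have : ∀ j ∈ t, ∑ i ∈ s, α j * (f j i / ∑ i ∈ s, f j i) = α j := by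
      intro j hj
      rw [← mul_sum, ← sum_div, div_self (h j hj), mul_one]
    rw [sum_congr rfl this, hαsum, mul_one]

theorem matListProd_succ {n k : ℕ} (A : Fin (k + 1) → Matrix (Fin n) (Fin n) ℝ) :
    matListProd A = A 0 * matListProd fun i => A i.succ := by
  simp [matListProd, List.ofFn_succ]

theorem matListProd_nonneg {n k : ℕ} (A : Fin k → Matrix (Fin n) (Fin n) ℝ)
    (hA : ∀ i x y, 0 ≤ A i x y) (x y : Fin n) : 0 ≤ matListProd A x y := by
  induction k generalizing x with
  | zero =>
    simp only [matListProd, List.ofFn_zero, List.prod_nil, Matrix.one_apply]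
    split_ifs <;> norm_num
  | succ k ih =>
    rw [matListProd_succ, Matrix.mul_apply]
    exact Finset.sum_nonneg fun z _ => mul_nonneg (hA _ _ _) (ih _ (fun i => hA i.succ) z)

theorem hadWMean_nonneg {n m : ℕ} (α : Fin m → ℝ) (A : Fin m → Matrix (Fin n) (Fin n) ℝ)
    (hA : ∀ j x y, 0 ≤ A j x y) (x y : Fin n) : 0 ≤ hadWMean α A x y := by
  simp only [hadWMean, Matrix.of_apply]
  exact Finset.prod_nonneg fun j _ => Real.rpow_nonneg (hA j x y) _

theorem matListProd_hadWMean_le {k m n : ℕ} (A : Fin k → Fin m → Matrix (Fin n) (Fin n) ℝ)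
    (hA : ∀ i j x y, 0 ≤ A i j x y)
    (α : Fin m → ℝ) (hα : ∀ j, 0 < α j) (hαsum : ∑ j, α j = 1) (x y : Fin n) :
    matListProd (fun i => hadWMean α (A i)) x y ≤
      hadWMean α (fun j => matListProd fun i => A i j) x y := by
  induction k generalizing x with
  | zero =>
    simp only [matListProd, List.ofFn_zero, List.prod_nil, hadWMean, Matrix.of_apply,
      Matrix.one_apply]
    split_ifs
    · simp
    · exact Finset.prod_nonneg fun j _ => Real.rpow_nonneg le_rfl _
  | succ k ih =>
    rw [matListProd_succ, Matrix.mul_apply]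
    calc _ ≤ ∑ z, hadWMean α (A 0) x z *
          hadWMean α (fun j => matListProd fun i => A i.succ j) z y :=
          Finset.sum_le_sum fun z _ => mul_le_mul_of_nonneg_left
            (ih (fun i => A i.succ) (fun i => hA i.succ) z) (hadWMean_nonneg _ _ (hA 0) _ _)
      _ = ∑ z, ∏ j, (A 0 j x z * matListProd (fun i => A i.succ j) z y) ^ α j := by
          refine Finset.sum_congr rfl fun z _ => ?_
          simp only [hadWMean, Matrix.of_apply, ← Finset.prod_mul_distrib]
          refine Finset.prod_congr rfl fun j _ => ?_
          rw [Real.mul_rpow (hA _ _ _ _) (matListProd_nonneg _ (fun i => hA i.succ j) _ _)]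
      _ ≤ ∏ j, (∑ z, A 0 j x z * matListProd (fun i => A i.succ j) z y) ^ α j :=
          sum_prod_rpow_le_prod_sum_rpow _ _ _
            (fun j _ z _ => mul_nonneg (hA _ _ _ _)
              (matListProd_nonneg _ (fun i => hA i.succ j) _ _)) _ (fun j _ => hα j) hαsum
      _ = _ := by
          simp only [hadWMean, Matrix.of_apply, matListProd_succ, Matrix.mul_apply]

theorem opNorm_nonneg {n : ℕ} (A : Matrix (Fin n) (Fin n) ℝ) : 0 ≤ opNorm A :=
  norm_nonneg _

theorem sum_mulVec_sq_le_opNorm_sq_mul {n : ℕ} (A : Matrix (Fin n) (Fin n) ℝ)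
    (v : Fin n → ℝ) :
    ∑ x, (A.mulVec v x) ^ 2 ≤ opNorm A ^ 2 * ∑ x, v x ^ 2 := by
  have h := (LinearMap.toContinuousLinearMap (Matrix.toEuclideanLin A)).le_opNorm
    (WithLp.toLp 2 v)
  have h2 := pow_le_pow_left₀ (norm_nonneg _) h 2
  rw [mul_pow, EuclideanSpace.real_norm_sq_eq, EuclideanSpace.real_norm_sq_eq] at h2
  exact h2

/-- A matrix dominated entrywise in absolute value by a weighted Hadamard geometric mean of
nonnegative matrices has norm at most the weighted geometric mean of their norms. -/
theorem opNorm_le_of_abs_le_hadWMean {m n : ℕ} (M : Matrix (Fin n) (Fin n) ℝ)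
    (B : Fin m → Matrix (Fin n) (Fin n) ℝ) (hB : ∀ j x y, 0 ≤ B j x y)
    (α : Fin m → ℝ) (hα : ∀ j, 0 < α j) (hαsum : ∑ j, α j = 1)
    (hM : ∀ x y, |M x y| ≤ hadWMean α B x y) :
    opNorm M ≤ ∏ j, opNorm (B j) ^ α j := by
  have hP : 0 ≤ ∏ j, opNorm (B j) ^ α j :=
    Finset.prod_nonneg fun j _ => Real.rpow_nonneg (opNorm_nonneg _) _
  have hprod : ∀ c : ℝ, 0 ≤ c → ∏ j, c ^ α j = c := fun c hc => by
    rw [← Real.rpow_sum_of_nonneg hc fun j _ => (hα j).le, hαsum, Real.rpow_one]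
  have hpow : ∀ f : Fin m → ℝ, (∀ j, 0 ≤ f j) →
      (∏ j, f j ^ α j) ^ 2 = ∏ j, (f j ^ 2) ^ α j := fun f hf => by
    rw [← Finset.prod_pow]
    exact Finset.prod_congr rfl fun j _ => Real.rpow_pow_comm (hf j) _ _
  refine ContinuousLinearMap.opNorm_le_bound _ hP fun v => ?_
  refine le_of_sq_le_sq ?_ (mul_nonneg hP (norm_nonneg _))
  set w : Fin n → ℝ := fun y => |v y| with hw
  have hw0 : ∀ y, 0 ≤ w y := fun y => abs_nonneg _
  have hBw : ∀ j x, 0 ≤ (B j).mulVec w x := fun j x => by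
    simp only [Matrix.mulVec, dotProduct]
    exact Finset.sum_nonneg fun y _ => mul_nonneg (hB j x y) (hw0 y)
  have hvw : ∑ y, w y ^ 2 = ‖v‖ ^ 2 := by
    simp [hw, EuclideanSpace.real_norm_sq_eq]
  have hrow : ∀ x, |M.mulVec v x| ≤ ∏ j, (B j).mulVec w x ^ α j := fun x =>
    calc |M.mulVec v x| ≤ ∑ y, |M x y * v y| := by
          simp only [Matrix.mulVec, dotProduct]
          exact Finset.abs_sum_le_sum_abs _ _
      _ ≤ ∑ y, ∏ j, (B j x y * w y) ^ α j := by
          refine Finset.sum_le_sum fun y _ => ?_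
          rw [abs_mul]
          refine (mul_le_mul_of_nonneg_right (hM x y) (hw0 y)).trans_eq ?_
          simp only [hadWMean, Matrix.of_apply]
          conv_lhs => rw [← hprod (w y) (hw0 y), ← Finset.prod_mul_distrib]
          exact Finset.prod_congr rfl fun j _ => (Real.mul_rpow (hB j x y) (hw0 y)).symm
      _ ≤ _ := sum_prod_rpow_le_prod_sum_rpow _ _ _
          (fun j _ y _ => mul_nonneg (hB j x y) (hw0 y)) _ (fun j _ => hα j) hαsum
  rw [EuclideanSpace.real_norm_sq_eq, mul_pow, hpow _ fun j => opNorm_nonneg _, ← hvw]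
  calc ∑ x, (M.mulVec v x) ^ 2 ≤ ∑ x, ∏ j, ((B j).mulVec w x ^ 2) ^ α j := by
        refine Finset.sum_le_sum fun x _ => ?_
        rw [← hpow _ fun j => hBw j x, ← sq_abs]
        exact pow_le_pow_left₀ (abs_nonneg _) (hrow x) 2
    _ ≤ ∏ j, (∑ x, (B j).mulVec w x ^ 2) ^ α j :=
        sum_prod_rpow_le_prod_sum_rpow _ _ _ (fun _ _ _ _ => sq_nonneg _) _
          (fun j _ => hα j) hαsum
    _ ≤ ∏ j, (opNorm (B j) ^ 2 * ∑ y, w y ^ 2) ^ α j :=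
        Finset.prod_le_prod
          (fun j _ => Real.rpow_nonneg (Finset.sum_nonneg fun _ _ => sq_nonneg _) _)
          fun j _ => Real.rpow_le_rpow (Finset.sum_nonneg fun _ _ => sq_nonneg _)
            (sum_mulVec_sq_le_opNorm_sq_mul _ _) (hα j).le
    _ = (∏ j, (opNorm (B j) ^ 2) ^ α j) * ∑ y, w y ^ 2 := by
        have hs : 0 ≤ ∑ y, w y ^ 2 := Finset.sum_nonneg fun _ _ => sq_nonneg _
        conv_rhs => rw [← hprod _ hs, ← Finset.prod_mul_distrib]
        exact Finset.prod_congr rfl fun j _ => Real.mul_rpow (sq_nonneg _) hs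

/-- Theorem 2.1, inequality (5): operator-norm inequality for the product of
weighted Hadamard geometric means of non-negative matrices. -/
theorem hadamard_mean_prod_opNorm_le {k m n : ℕ} (hk : 0 < k) (hm : 0 < m)
    (hn : 0 < n) (A : Fin k → Fin m → Matrix (Fin n) (Fin n) ℝ)
    (hA : ∀ i j x y, 0 ≤ A i j x y)
    (α : Fin m → ℝ) (hα : ∀ j, 0 < α j) (hαsum : ∑ j, α j = 1) :
    opNorm (matListProd (fun i => hadWMean α (A i))) ≤
      ∏ j, opNorm (matListProd (fun i => A i j)) ^ (α j) := by
  refine opNorm_le_of_abs_le_hadWMean _ _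
    (fun j => matListProd_nonneg _ fun i => hA i j) α hα hαsum fun x y => ?_
  rw [abs_of_nonneg (matListProd_nonneg _ (fun i => hadWMean_nonneg _ _ (hA i)) x y)]
  exact matListProd_hadWMean_le A hA α hα hαsum x y
end

section
/- Let n be a positive integer and let A and B be n×n matrices with nonnegative real entries. Then ρ(A^(1/2) ∘ B^(1/2)) ≤ ρ(AB)^{1/2}. -/
open scoped ENNReal NNReal BigOperators

/-- Entrywise domination of a nonnegative matrix `C` by the Hadamard geometric mean of the
nonnegative matrices `D` and `E`. -/
structure LeGeomMean {n : ℕ} (C D E : Matrix (Fin n) (Fin n) ℝ) : Prop where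
  nonneg : ∀ x y, 0 ≤ C x y
  nonneg_left : ∀ x y, 0 ≤ D x y
  nonneg_right : ∀ x y, 0 ≤ E x y
  le : ∀ x y, C x y ≤ √(D x y) * √(E x y)

namespace LeGeomMean

variable {n : ℕ} {C D E C' D' E' : Matrix (Fin n) (Fin n) ℝ}

theorem one : LeGeomMean (1 : Matrix (Fin n) (Fin n) ℝ) 1 1 := by
  have h : ∀ x y, 0 ≤ (1 : Matrix (Fin n) (Fin n) ℝ) x y := fun x y => by
    rw [Matrix.one_apply]; split_ifs <;> simp
  exact ⟨h, h, h, fun x y => (Real.mul_self_sqrt (h x y)).ge⟩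

theorem mul (h : LeGeomMean C D E) (h' : LeGeomMean C' D' E') :
    LeGeomMean (C * C') (D * D') (E * E') where
  nonneg x y := by
    rw [Matrix.mul_apply]
    exact Finset.sum_nonneg fun z _ => mul_nonneg (h.nonneg x z) (h'.nonneg z y)
  nonneg_left x y := by
    rw [Matrix.mul_apply]
    exact Finset.sum_nonneg fun z _ => mul_nonneg (h.nonneg_left x z) (h'.nonneg_left z y)
  nonneg_right x y := by
    rw [Matrix.mul_apply]
    exact Finset.sum_nonneg fun z _ => mul_nonneg (h.nonneg_right x z) (h'.nonneg_right z y)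
  le x y := by
    simp only [Matrix.mul_apply]
    refine le_trans (Finset.sum_le_sum fun z _ => ?_) (Real.sum_sqrt_mul_sqrt_le _
      (fun z => mul_nonneg (h.nonneg_left x z) (h'.nonneg_left z y))
      (fun z => mul_nonneg (h.nonneg_right x z) (h'.nonneg_right z y)))
    rw [Real.sqrt_mul (h.nonneg_left x z), Real.sqrt_mul (h.nonneg_right x z),
      mul_mul_mul_comm]
    exact mul_le_mul (h.le x z) (h'.le z y) (h'.nonneg z y) (by positivity)

theorem pow (h : LeGeomMean C D E) (k : ℕ) : LeGeomMean (C ^ k) (D ^ k) (E ^ k) := by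
  induction k with
  | zero => simpa only [pow_zero] using one
  | succ k ih => simpa only [pow_succ] using ih.mul h

theorem sum_row_le (h : LeGeomMean C D E) (x : Fin n) :
    ∑ y, C x y ≤ √(∑ y, D x y) * √(∑ y, E x y) :=
  (Finset.sum_le_sum fun y _ => h.le x y).trans
    (Real.sum_sqrt_mul_sqrt_le _ (h.nonneg_left x) (h.nonneg_right x))

end LeGeomMean

section RowSumNorm

open Filter

attribute [local instance] Matrix.linftyOpNormedRing Matrix.linftyOpNormedAlgebra

variable {n : ℕ} {C D E : Matrix (Fin n) (Fin n) ℝ}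

theorem sum_row_le_nnnorm_map (hD : ∀ x y, 0 ≤ D x y) (x : Fin n) :
    ∑ y, D x y ≤ ‖D.map (fun t => (t : ℂ))‖₊ := by
  have h : ∑ y, ‖D.map (fun t => (t : ℂ)) x y‖₊ ≤ ‖D.map (fun t => (t : ℂ))‖₊ := by
    rw [Matrix.linfty_opNNNorm_def]
    exact Finset.le_sup (f := fun x => ∑ y, ‖D.map (fun t => (t : ℂ)) x y‖₊)
      (Finset.mem_univ x)
  refine le_trans (le_of_eq ?_) (NNReal.coe_le_coe.mpr h)
  push_cast
  exact Finset.sum_congr rfl fun y _ => by simp [abs_of_nonneg (hD x y)]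

theorem LeGeomMean.nnnorm_map_le (h : LeGeomMean C D E) :
    ‖C.map (fun t => (t : ℂ))‖₊ ≤
      ‖D.map (fun t => (t : ℂ))‖₊ ^ ((1 : ℝ) / 2) *
        ‖E.map (fun t => (t : ℂ))‖₊ ^ ((1 : ℝ) / 2) := by
  rw [← NNReal.sqrt_eq_rpow, ← NNReal.sqrt_eq_rpow,
    Matrix.linfty_opNNNorm_def (C.map fun t => (t : ℂ))]
  refine Finset.sup_le fun x _ => ?_
  rw [← NNReal.coe_le_coe]
  push_cast
  refine le_trans (le_of_eq ?_) ((h.sum_row_le x).trans ?_)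
  · exact Finset.sum_congr rfl fun y _ => by simp [abs_of_nonneg (h.nonneg x y)]
  · gcongr
    · exact sum_row_le_nnnorm_map h.nonneg_left x
    · exact sum_row_le_nnnorm_map h.nonneg_right x

theorem Matrix.map_ofReal_pow (C : Matrix (Fin n) (Fin n) ℝ) (k : ℕ) :
    (C ^ k).map (fun t => (t : ℂ)) = C.map (fun t => (t : ℂ)) ^ k :=
  map_pow (Complex.ofRealHom.mapMatrix (m := Fin n)) C k

theorem tendsto_nnnorm_pow_specRad (C : Matrix (Fin n) (Fin n) ℝ) :
    Tendsto (fun k : ℕ => (‖(C ^ k).map (fun t => (t : ℂ))‖₊ : ℝ≥0∞) ^ (1 / k : ℝ)) atTop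
      (nhds (specRad C)) := by
  have : CompleteSpace (Matrix (Fin n) (Fin n) ℂ) := FiniteDimensional.complete ℂ _
  simp only [Matrix.map_ofReal_pow]
  exact spectrum.pow_nnnorm_pow_one_div_tendsto_nhds_spectralRadius _

theorem LeGeomMean.specRad_le (h : LeGeomMean C D E) (hDE : specRad D = specRad E) :
    specRad C ≤ specRad D := by
  have hD := (tendsto_nnnorm_pow_specRad D).ennrpow_const ((1 : ℝ) / 2)
  have hE := (tendsto_nnnorm_pow_specRad E).ennrpow_const ((1 : ℝ) / 2)
  have hsq : specRad D ^ ((1 : ℝ) / 2) * specRad D ^ ((1 : ℝ) / 2) = specRad D := by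
    rw [← ENNReal.rpow_add_of_nonneg _ _ (by norm_num) (by norm_num)]
    norm_num
  have hfin : specRad D ≠ ∞ := by
    have : CompleteSpace (Matrix (Fin n) (Fin n) ℂ) := FiniteDimensional.complete ℂ _
    refine ne_top_of_le_ne_top ?_ (spectrum.spectralRadius_le_pow_nnnorm_pow_one_div ℂ
      (D.map (fun t => (t : ℂ))) 0)
    exact (ENNReal.mul_lt_top (by simp) (by simp)).ne
  have hfin' : specRad D ^ ((1 : ℝ) / 2) ≠ ∞ :=
    ENNReal.rpow_ne_top_of_nonneg (by norm_num) hfin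
  rw [← hDE] at hE
  have hDE' := ENNReal.Tendsto.mul hD (Or.inr hfin') hE (Or.inr hfin')
  rw [hsq] at hDE'
  refine le_of_tendsto_of_tendsto' (tendsto_nnnorm_pow_specRad C) hDE' fun k => ?_
  have hcomm : ∀ a : ℝ≥0∞, (a ^ (1 / k : ℝ)) ^ ((1 : ℝ) / 2) =
      (a ^ ((1 : ℝ) / 2)) ^ (1 / k : ℝ) := fun a => by
    rw [← ENNReal.rpow_mul, ← ENNReal.rpow_mul, mul_comm]
  rw [hcomm, hcomm, ← ENNReal.mul_rpow_of_nonneg _ _ (by positivity)]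
  refine ENNReal.rpow_le_rpow ?_ (by positivity)
  rw [← ENNReal.coe_rpow_of_nonneg _ (by norm_num), ← ENNReal.coe_rpow_of_nonneg _ (by norm_num)]
  exact_mod_cast (h.pow k).nnnorm_map_le

end RowSumNorm

theorem spectralRadius_mul_comm {𝕜 R : Type*} [NormedField 𝕜] [Ring R] [Algebra 𝕜 R] (a b : R) :
    spectralRadius 𝕜 (a * b) = spectralRadius 𝕜 (b * a) := by
  have key : ∀ a b : R, spectralRadius 𝕜 (a * b) ≤ spectralRadius 𝕜 (b * a) := fun a b => by
    refine iSup₂_le fun k hk => ?_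
    rcases eq_or_ne k 0 with rfl | hk0
    · simp
    · have hmem : k ∈ spectrum 𝕜 (b * a) \ {0} := by
        rw [← spectrum.nonzero_mul_comm]
        exact ⟨hk, hk0⟩
      exact le_iSup₂ (f := fun (k : 𝕜) (_ : k ∈ spectrum 𝕜 (b * a)) => (‖k‖₊ : ℝ≥0∞)) k hmem.1
  exact le_antisymm (key a b) (key b a)

theorem specRad_mul_comm {n : ℕ} (A B : Matrix (Fin n) (Fin n) ℝ) :
    specRad (A * B) = specRad (B * A) := by
  have h : ∀ A B : Matrix (Fin n) (Fin n) ℝ, (A * B).map (fun t => (t : ℂ)) =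
      A.map (fun t => (t : ℂ)) * B.map (fun t => (t : ℂ)) :=
    map_mul (Complex.ofRealHom.mapMatrix (m := Fin n))
  rw [specRad, specRad, h, h, spectralRadius_mul_comm]

/-- Schep's inequality (2): `ρ(A^(1/2) ∘ B^(1/2)) ≤ ρ(AB)^(1/2)` for
non-negative matrices. -/
theorem specRad_hadamard_geom_mean_le {n : ℕ} (hn : 0 < n)
    (A B : Matrix (Fin n) (Fin n) ℝ) (hA : ∀ x y, 0 ≤ A x y)
    (hB : ∀ x y, 0 ≤ B x y) :
    specRad (Matrix.of fun x y => (A x y) ^ ((1 : ℝ) / 2) * (B x y) ^ ((1 : ℝ) / 2)) ≤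
      specRad (A * B) ^ ((1 : ℝ) / 2) := by
  set M : Matrix (Fin n) (Fin n) ℝ :=
    Matrix.of fun x y => (A x y) ^ ((1 : ℝ) / 2) * (B x y) ^ ((1 : ℝ) / 2)
  have hM : ∀ x y, M x y = √(A x y) * √(B x y) := fun x y => by
    simp only [M, Matrix.of_apply, Real.sqrt_eq_rpow]
  have hAB : LeGeomMean M A B :=
    ⟨fun x y => by rw [hM]; positivity, hA, hB, fun x y => (hM x y).le⟩
  have hBA : LeGeomMean M B A :=
    ⟨hAB.nonneg, hB, hA, fun x y => by rw [hM, mul_comm]⟩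
  have hsq : specRad (M ^ 2) ≤ specRad (A * B) := by
    rw [sq]
    exact (hAB.mul hBA).specRad_le (specRad_mul_comm A B)
  have hpow : specRad M ^ 2 ≤ specRad (M ^ 2) := by
    rw [specRad, specRad, Matrix.map_ofReal_pow]
    exact spectrum.spectralRadius_pow_le _ 2 two_ne_zero
  rw [one_div, ENNReal.le_rpow_inv_iff two_pos]
  exact_mod_cast hpow.trans hsq
end
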